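/- arXiv:math/0606410 — 2 statements merged into one kernel-verified Lean document; each statement's English description precedes it below -/
import Mathlib

section
/- Let (M̃, h, ∇̃) be an ambient manifold with ambient metric h and ambient connection ∇̃ such that dφ|_Q = 0 and T*|_Q = 0, where φ := h(F,·). Then the curvature R̃ of ∇̃ satisfies R̃(X,Y)F = 0 for all X, Y ∈ TQ. -/
/-!
STATEMENT 9.  Let (M̃, h, ∇̃) be an ambient manifold with ambient metric h and
ambient connection ∇̃ such that dφ|_Q = 0 and T*|_Q = 0, where φ := h(F,·).
Then the curvature R̃ of ∇̃ satisfies R̃(X,Y)F = 0 for all X, Y ∈ TQ.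

We model the smooth structure algebraically: `F` is the commutative ℝ-algebra of
smooth functions on M̃, `V` the `F`-module of smooth vector fields, `app X f` is
the derivative `X(f)`, `bracket` the Lie bracket, `h` the ambient metric, `conn`
the ambient connection and `Fv` the fundamental vector field of the ℝ⁺-action.
Restriction to the embedded ray bundle ι(Q) ⊆ M̃ is modeled by a ring
homomorphism `ρ : F →+* FQ` (restriction of functions to Q) and a compatible
additive map `ρV : V →+ VQ` (restriction of vector fields to Q); a tensor
"vanishes along Q" when its ρ-image vanishes.  `tq` is the set of vector fields
on M̃ that are tangent to Q along Q; tangency is characterised by the property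
that the derivative along such a field of any function vanishing on Q again
vanishes on Q.  The curvature of the connection is
`R̃(X,Y)Z = ∇̃_X ∇̃_Y Z − ∇̃_Y ∇̃_X Z − ∇̃_{[X,Y]} Z`.
-/

/-- The (2,1)-torsion of a connection. -/
def torsion {V : Type} [AddCommGroup V]
    (bracket conn : V → V → V) : V → V → V :=
  fun X Y => conn X Y - conn Y X - bracket X Y

/-- The (3,0)-torsion `T*(X,Y,Z) = h(T(X,Y),Z)`. -/
def torsionStar {F V : Type} [AddCommGroup V]
    (h : V → V → F) (bracket conn : V → V → V) : V → V → V → F :=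
  fun X Y Z => h (torsion bracket conn X Y) Z

/-- The curvature tensor of a connection. -/
def curv {V : Type} [AddCommGroup V]
    (bracket conn : V → V → V) : V → V → V → V :=
  fun X Y Z => conn X (conn Y Z) - conn Y (conn X Z) - conn (bracket X Y) Z

theorem stmt9 {F V FQ VQ : Type} [CommRing F] [Algebra ℝ F]
    [AddCommGroup V] [Module F V]
    [CommRing FQ] [AddCommGroup VQ] [Module FQ VQ]
    (app : V → F → F) (bracket : V → V → V)
    (h : V → V → F) (conn : V → V → V)
    (Fv : V)
    -- derivations and bracket axioms
    (happ_add : ∀ X f g, app X (f + g) = app X f + app X g)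
    (happ_mul : ∀ X f g, app X (f * g) = app X f * g + f * app X g)
    (happ_smulV : ∀ (f : F) (X : V) (g : F), app (f • X) g = f * app X g)
    (hskew : ∀ X Y, bracket X Y = - bracket Y X)
    (hbr_app : ∀ X Y f, app (bracket X Y) f = app X (app Y f) - app Y (app X f))
    (hbr_leib : ∀ X (f : F) Y, bracket X (f • Y) = app X f • Y + f • bracket X Y)
    -- h is a metric
    (hsymm : ∀ X Y, h X Y = h Y X)
    (hbil_add : ∀ X Y Z, h (X + Y) Z = h X Z + h Y Z)
    (hbil_smul : ∀ (f : F) X Y, h (f • X) Y = f * h X Y)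
    -- ∇̃ is a linear connection, metric w.r.t. h
    (hconn_addl : ∀ X Y Z, conn (X + Y) Z = conn X Z + conn Y Z)
    (hconn_smull : ∀ (f : F) X Y, conn (f • X) Y = f • conn X Y)
    (hconn_addr : ∀ X Y Z, conn X (Y + Z) = conn X Y + conn X Z)
    (hconn_leib : ∀ X (f : F) Y, conn X (f • Y) = app X f • Y + f • conn X Y)
    (hmetric : ∀ X Y Z, app X (h Y Z) = h (conn X Y) Z + h Y (conn X Z))
    -- ambient metric: L_Fv h = 2h;  ambient connection: L_Fv T* = 2T*
    (hhom : ∀ X Y,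
      app Fv (h X Y) - h (bracket Fv X) Y - h X (bracket Fv Y) = 2 * h X Y)
    (hThom : ∀ X Y Z,
      app Fv (torsionStar h bracket conn X Y Z)
        - torsionStar h bracket conn (bracket Fv X) Y Z
        - torsionStar h bracket conn X (bracket Fv Y) Z
        - torsionStar h bracket conn X Y (bracket Fv Z)
        = 2 * torsionStar h bracket conn X Y Z)
    -- restriction to Q
    (ρ : F →+* FQ) (ρV : V →+ VQ)
    (hρV_smul : ∀ (f : F) (X : V), ρV (f • X) = ρ f • ρV X)
    -- along Q the metric is non-degenerate: a field whose h-pairing with every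
    -- field vanishes along Q vanishes along Q
    (hnondegQ : ∀ X : V, (∀ Y, ρ (h X Y) = 0) → ρV X = 0)
    -- vector fields tangent to Q
    (tq : Set V)
    (hFvtq : Fv ∈ tq)
    (htq_br : ∀ X ∈ tq, ∀ Y ∈ tq, bracket X Y ∈ tq)
    (htq : ∀ X ∈ tq, ∀ f : F, ρ f = 0 → ρ (app X f) = 0)
    -- hypothesis dφ|_Q = 0, where φ = h(Fv,·) and
    -- dφ(X,Y) = X(φ(Y)) − Y(φ(X)) − φ([X,Y])
    (hdphiQ : ∀ X Y : V,
      ρ (app X (h Fv Y) - app Y (h Fv X) - h Fv (bracket X Y)) = 0)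
    -- hypothesis T*|_Q = 0
    (hTQ : ∀ X Y Z : V, ρ (torsionStar h bracket conn X Y Z) = 0) :
    -- conclusion: R̃(X,Y)F = 0 along Q for all X, Y tangent to Q
    ∀ X ∈ tq, ∀ Y ∈ tq, ρV (curv bracket conn X Y Fv) = 0 := by
  have hsub : ∀ X Y Z, h (X - Y) Z = h X Z - h Y Z := fun X Y Z => by
    rw [eq_sub_iff_add_eq, ← hbil_add, sub_add_cancel]
  have hconn_sub : ∀ X Y Z, conn X (Y - Z) = conn X Y - conn X Z := fun X Y Z => by
    rw [eq_sub_iff_add_eq, ← hconn_addr, sub_add_cancel]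
  have htorsion : ∀ X Y Z,
      torsionStar h bracket conn X Y Z = h (conn X Y) Z - h (conn Y X) Z - h (bracket X Y) Z :=
    fun X Y Z => by simp only [torsionStar, torsion, hsub]
  have htwo : IsUnit (2 : FQ) := by
    have hF : IsUnit (2 : F) := by
      exact map_ofNat (algebraMap ℝ F) 2 ▸
        (IsUnit.mk0 (2 : ℝ) two_ne_zero).map (algebraMap ℝ F)
    exact map_ofNat ρ 2 ▸ hF.map ρ
  -- along `Q` the derivative of the fundamental field is the identity
  have hconnF : ∀ X Y, ρ (h (conn X Fv - X) Y) = 0 := fun X Y => by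
    refine htwo.mul_left_cancel ?_
    have key : 2 * h (conn X Fv - X) Y
        = (app X (h Fv Y) - app Y (h Fv X) - h Fv (bracket X Y))
          - torsionStar h bracket conn X Y Fv
          - torsionStar h bracket conn Fv X Y - torsionStar h bracket conn Fv Y X := by
      have hFXY := hhom X Y
      rw [hmetric] at hFXY
      rw [htorsion, htorsion, htorsion, hsub, hmetric, hmetric, hsymm Fv (conn X Y),
        hsymm Fv (conn Y X), hsymm Fv (bracket X Y)]
      rw [hsymm X (conn Fv Y), hsymm X (bracket Fv Y)] at hFXY
      linear_combination hFXY
    have hρ := congrArg ρ key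
    rw [map_sub, map_sub, map_sub, hdphiQ, hTQ, hTQ, hTQ, map_mul, map_ofNat] at hρ
    simpa using hρ
  have hconn_vanish : ∀ X ∈ tq, ∀ Y Z, ρ (h (conn X (conn Y Fv - Y)) Z) = 0 :=
    fun X hX Y Z => by
      rw [eq_sub_of_add_eq (hmetric X (conn Y Fv - Y) Z).symm, map_sub,
        htq X hX _ (hconnF Y Z), hconnF, sub_zero]
  intro X hX Y hY
  refine hnondegQ _ fun Z => ?_
  have key : h (curv bracket conn X Y Fv) Z
      = h (conn X (conn Y Fv - Y)) Z - h (conn Y (conn X Fv - X)) Z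
        - h (conn (bracket X Y) Fv - bracket X Y) Z + torsionStar h bracket conn X Y Z := by
    simp only [curv, htorsion, hconn_sub, hsub]
    ring
  rw [key, map_add, map_sub, map_sub, hconn_vanish X hX, hconn_vanish Y hY, hconnF, hTQ]
  simp
end

section
/- For the explicit ambient manifold M̃ = ℝ × M × ℝ⁺ over a pseudo-Riemannian manifold (M,g), with the metric h and the connection ∇̃ defined using the Schouten tensor P and the bundle automorphism f, the connection is metric: ∇̃h = 0. -/
/-- The curvature tensor of a connection. -/
def curvOf {V : Type} [AddCommGroup V] (bracket conn : V → V → V) :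
    V → V → V → V :=
  fun X Y Z => conn X (conn Y Z) - conn Y (conn X Z) - conn (bracket X Y) Z

/-- The torsion of a connection. -/
def torsionOf {V : Type} [AddCommGroup V] (bracket conn : V → V → V) :
    V → V → V :=
  fun X Y => conn X Y - conn Y X - bracket X Y

/--
Algebraic model of the explicit ambient construction of the paper on
M̃ = ℝ × M × ℝ⁺ over a pseudo-Riemannian manifold (M, g) of dimension n ≥ 3.

`FM`/`VM` are the smooth functions/vector fields on M (a Lie–Rinehart pair),
`appM` the derivative of a function along a field and `bracketM` the Lie
bracket; `g` is the metric, `conn0` its Levi-Civita connection, `E` a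
g-orthonormal frame, `Ric`, `scal` the Ricci and scalar curvature, `P`/`Pb` the
Schouten tensor (as endomorphism/bilinear form), `CY` the Cotton–York tensor
and `W` the Weyl tensor.

`F`/`V` are the smooth functions/vector fields on M̃ = ℝ × M × ℝ⁺, with the
pullbacks `ιF` of functions, the coordinates `s`, `q` (with `q` invertible),
their coordinate vector fields `S`, `Q`, the horizontal lift `lift X` of a
vector field X of M, and `tilde X = f(X) = (sP + q·Id)⁻¹ X`.  The ambient
metric `h` and ambient connection `conn` are defined by the formulas of the
paper.  The fundamental vector field of the ℝ⁺-action φ_t(s,x,q) = (ts,x,tq)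
is F = s·S + q·Q.  Restriction to the embedded ray bundle 𝒬 = {s = 0} is
modeled by the homomorphisms `res`/`resV` (with `res s = 0`).
-/
structure ExplicitAmbient where
  -- ===== the base pseudo-Riemannian manifold (M, g) =====
  FM : Type
  [instFM : CommRing FM]
  [instFMA : Algebra ℝ FM]
  VM : Type
  [instVM : AddCommGroup VM]
  [instVMM : Module FM VM]
  appM : VM → FM → FM
  bracketM : VM → VM → VM
  appM_add : ∀ X f f', appM X (f + f') = appM X f + appM X f'
  appM_mul : ∀ X f f', appM X (f * f') = appM X f * f' + f * appM X f'
  appM_smulV : ∀ (f : FM) (X : VM) (f' : FM), appM (f • X) f' = f * appM X f'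
  bracketM_skew : ∀ X Y, bracketM X Y = - bracketM Y X
  bracketM_leib : ∀ X (f : FM) Y,
    bracketM X (f • Y) = appM X f • Y + f • bracketM X Y
  bracketM_app : ∀ X Y f,
    appM (bracketM X Y) f = appM X (appM Y f) - appM Y (appM X f)
  -- the metric g
  g : VM → VM → FM
  g_symm : ∀ X Y, g X Y = g Y X
  g_addl : ∀ X Y Z, g (X + Y) Z = g X Z + g Y Z
  g_smull : ∀ (f : FM) (X Y : VM), g (f • X) Y = f * g X Y
  -- dimension n ≥ 3 and a g-orthonormal frame
  dim : ℕ
  three_le_dim : 3 ≤ dim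
  E : Fin dim → VM
  E_orth : ∀ i j, g (E i) (E j) = if i = j then 1 else 0
  E_span : ∀ X : VM, X = ∑ i, g X (E i) • E i
  -- the Levi-Civita connection of g
  conn0 : VM → VM → VM
  conn0_addl : ∀ X Y Z, conn0 (X + Y) Z = conn0 X Z + conn0 Y Z
  conn0_smull : ∀ (f : FM) (X Y : VM), conn0 (f • X) Y = f • conn0 X Y
  conn0_addr : ∀ X Y Z, conn0 X (Y + Z) = conn0 X Y + conn0 X Z
  conn0_leib : ∀ X (f : FM) Y, conn0 X (f • Y) = appM X f • Y + f • conn0 X Y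
  conn0_metric : ∀ X Y Z,
    appM X (g Y Z) = g (conn0 X Y) Z + g Y (conn0 X Z)
  conn0_torsionfree : ∀ X Y, conn0 X Y - conn0 Y X = bracketM X Y
  -- Ricci tensor, scalar curvature, Schouten tensor P, Cotton–York CY, Weyl W
  Ric : VM → VM → FM
  Ric_def : ∀ X Y, Ric X Y = ∑ i, g (curvOf bracketM conn0 (E i) X Y) (E i)
  scal : FM
  scal_def : scal = ∑ i, Ric (E i) (E i)
  P : VM → VM
  Pb : VM → VM → FM
  P_dual : ∀ X Y, g (P X) Y = Pb X Y
  Pb_def : ∀ X Y, Pb X Y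
    = (-((1 : ℝ)/((dim : ℝ) - 2))) •
        (Ric X Y - ((1 : ℝ)/(2*(dim : ℝ) - 2)) • (scal * g X Y))
  CY : VM → VM → VM
  CY_def : ∀ X Y, CY X Y
    = (conn0 X (P Y) - P (conn0 X Y)) - (conn0 Y (P X) - P (conn0 Y X))
  W : VM → VM → VM → VM
  W_def : ∀ X Y Z, W X Y Z
    = curvOf bracketM conn0 X Y Z
      - g Y Z • P X + g X Z • P Y - Pb Y Z • X + Pb X Z • Y
  -- ===== the ambient manifold M̃ = ℝ × M × ℝ⁺ =====
  F : Type
  [instF : CommRing F]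
  [instFA : Algebra ℝ F]
  V : Type
  [instV : AddCommGroup V]
  [instVM' : Module F V]
  app : V → F → F
  bracket : V → V → V
  app_add : ∀ X f f', app X (f + f') = app X f + app X f'
  app_mul : ∀ X f f', app X (f * f') = app X f * f' + f * app X f'
  app_addV : ∀ X Y f, app (X + Y) f = app X f + app Y f
  app_smulV : ∀ (f : F) (X : V) (f' : F), app (f • X) f' = f * app X f'
  bracket_skew : ∀ X Y, bracket X Y = - bracket Y X
  bracket_leib : ∀ X (f : F) Y,
    bracket X (f • Y) = app X f • Y + f • bracket X Y
  bracket_app : ∀ X Y f,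
    app (bracket X Y) f = app X (app Y f) - app Y (app X f)
  -- pullback of functions of M, coordinates s and q, coordinate fields S and Q
  iota : FM →+* F
  iota_alg : ∀ c : ℝ, iota (algebraMap ℝ FM c) = algebraMap ℝ F c
  s : F
  q : F
  qinv : F
  q_inv : q * qinv = 1
  S : V
  Q : V
  -- horizontal lift of vector fields of M, and the map X ↦ X̃ = f(X)
  lift : VM → V
  tilde : VM → V
  lift_add : ∀ X Y, lift (X + Y) = lift X + lift Y
  lift_smul : ∀ (f : FM) (X : VM), lift (f • X) = iota f • lift X
  tilde_add : ∀ X Y, tilde (X + Y) = tilde X + tilde Y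
  tilde_smul : ∀ (f : FM) (X : VM), tilde (f • X) = iota f • tilde X
  -- f(X) = (sP + q·Id)⁻¹(X):  X = (sP + q·Id)(X̃), i.e. lift X = s·(PX)~ + q·X̃
  lift_eq : ∀ X : VM, lift X = s • tilde (P X) + q • tilde X
  -- derivatives of the coordinates and of pulled-back functions
  app_S_s : app S s = 1
  app_S_q : app S q = 0
  app_Q_s : app Q s = 0
  app_Q_q : app Q q = 1
  app_lift_s : ∀ X, app (lift X) s = 0
  app_lift_q : ∀ X, app (lift X) q = 0
  app_S_iota : ∀ f, app S (iota f) = 0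
  app_Q_iota : ∀ f, app Q (iota f) = 0
  app_lift_iota : ∀ X f, app (lift X) (iota f) = iota (appM X f)
  -- Lie brackets of the product structure
  bracket_S_Q : bracket S Q = 0
  bracket_S_lift : ∀ X, bracket S (lift X) = 0
  bracket_Q_lift : ∀ X, bracket Q (lift X) = 0
  bracket_lift : ∀ X Y, bracket (lift X) (lift Y) = lift (bracketM X Y)
  -- S, Q and the tildes span the ambient vector fields
  span : ∀ v : V, ∃ (a b : F) (m : ℕ) (c : Fin m → F) (X : Fin m → VM),
    v = a • S + b • Q + ∑ i, c i • tilde (X i)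
  -- ===== the ambient metric h =====
  h : V → V → F
  h_symm : ∀ X Y, h X Y = h Y X
  h_addl : ∀ X Y Z, h (X + Y) Z = h X Z + h Y Z
  h_smull : ∀ (f : F) (X Y : V), h (f • X) Y = f * h X Y
  h_S_Q : h S Q = 1
  h_S_S : h S S = 0
  h_Q_Q : h Q Q = 0
  h_S_tilde : ∀ X, h S (tilde X) = 0
  h_Q_tilde : ∀ X, h Q (tilde X) = 0
  h_tilde : ∀ X Y, h (tilde X) (tilde Y) = iota (g X Y)
  -- ===== the ambient connection ∇̃ =====
  conn : V → V → V
  conn_addl : ∀ X Y Z, conn (X + Y) Z = conn X Z + conn Y Z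
  conn_smull : ∀ (f : F) (X Y : V), conn (f • X) Y = f • conn X Y
  conn_addr : ∀ X Y Z, conn X (Y + Z) = conn X Y + conn X Z
  conn_leib : ∀ X (f : F) Y, conn X (f • Y) = app X f • Y + f • conn X Y
  conn_lift_tilde : ∀ X Y,
    conn (lift X) (tilde Y) = tilde (conn0 X Y) - iota (g X Y) • S - iota (Pb X Y) • Q
  conn_lift_Q : ∀ X, conn (lift X) Q = tilde X
  conn_lift_S : ∀ X, conn (lift X) S = tilde (P X)
  conn_Q_lift : ∀ X, conn Q (lift X) = tilde X
  conn_S_lift : ∀ X, conn S (lift X) = tilde (P X)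
  conn_S_S : conn S S = 0
  conn_S_Q : conn S Q = 0
  conn_Q_S : conn Q S = 0
  conn_Q_Q : conn Q Q = 0
  -- ===== restriction to the embedded ray bundle 𝒬 = {s = 0} =====
  F0 : Type
  [instF0 : CommRing F0]
  V0 : Type
  [instV0 : AddCommGroup V0]
  [instV0M : Module F0 V0]
  res : F →+* F0
  resV : V →+ V0
  resV_smul : ∀ (f : F) (X : V), resV (f • X) = res f • resV X
  res_s : res s = 0

attribute [instance] ExplicitAmbient.instFM ExplicitAmbient.instFMA
  ExplicitAmbient.instVM ExplicitAmbient.instVMM ExplicitAmbient.instF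
  ExplicitAmbient.instFA ExplicitAmbient.instV ExplicitAmbient.instVM'
  ExplicitAmbient.instF0 ExplicitAmbient.instV0 ExplicitAmbient.instV0M

/-- The fundamental vector field F = s·S + q·Q of the ℝ⁺-action on
M̃ = ℝ × M × ℝ⁺. -/
def ExplicitAmbient.Fv (A : ExplicitAmbient) : A.V := A.s • A.S + A.q • A.Q

namespace ExplicitAmbient

variable (A : ExplicitAmbient)

/-- The map `X ↦ X̃`, semilinear over the pullback of functions. -/
def tildeₛₗ : A.VM →ₛₗ[A.iota] A.V where
  toFun := A.tilde
  map_add' := A.tilde_add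
  map_smul' := A.tilde_smul

/-- The ambient metric as a bilinear form. -/
def hBilin : A.V →ₗ[A.F] A.V →ₗ[A.F] A.F :=
  LinearMap.mk₂ A.F A.h A.h_addl A.h_smull
    (fun X Y Z => by rw [A.h_symm X, A.h_addl, A.h_symm Y, A.h_symm Z])
    (fun f X Y => by rw [A.h_symm X, A.h_smull, A.h_symm Y, smul_eq_mul])

@[simp]
theorem hBilin_apply (X Y : A.V) : A.hBilin X Y = A.h X Y := rfl

theorem h_addr (X Y Z : A.V) : A.h X (Y + Z) = A.h X Y + A.h X Z := (A.hBilin X).map_add Y Z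

theorem h_smulr (f : A.F) (X Y : A.V) : A.h X (f • Y) = f * A.h X Y := (A.hBilin X).map_smul f Y

theorem h_subl (X Y Z : A.V) : A.h (X - Y) Z = A.h X Z - A.h Y Z :=
  LinearMap.congr_fun (A.hBilin.map_sub X Y) Z

theorem h_subr (X Y Z : A.V) : A.h X (Y - Z) = A.h X Y - A.h X Z := (A.hBilin X).map_sub Y Z

theorem h_zerol (X : A.V) : A.h 0 X = 0 := LinearMap.congr_fun A.hBilin.map_zero X

theorem h_zeror (X : A.V) : A.h X 0 = 0 := (A.hBilin X).map_zero

theorem app_zero (X : A.V) : A.app X 0 = 0 := by simpa using A.app_add X 0 0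

theorem app_one (X : A.V) : A.app X 1 = 0 := by simpa using A.app_mul X 1 1

/-- The covariant derivative in a fixed direction in the first slot, as a linear map. -/
def connLeft (Y : A.V) : A.V →ₗ[A.F] A.V where
  toFun X := A.conn X Y
  map_add' X X' := A.conn_addl X X' Y
  map_smul' f X := A.conn_smull f X Y

/-- The matrix of `sP + q·Id` in the orthonormal frame. -/
def liftMatrix : Matrix (Fin A.dim) (Fin A.dim) A.F :=
  fun i j => A.s * A.iota (A.g (A.P (A.E i)) (A.E j)) + if i = j then A.q else 0

/-- The matrix of the endomorphism `X̃ ↦ ∇̃_X̃ Q` in the orthonormal frame. -/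
def connQMatrix : Matrix (Fin A.dim) (Fin A.dim) A.F :=
  fun i j => A.h (A.conn (A.tilde (A.E i)) A.Q) (A.tilde (A.E j))

theorem map_eq_sum_frame (φ : A.VM →ₛₗ[A.iota] A.V) (X : A.VM) :
    φ X = ∑ i, A.iota (A.g X (A.E i)) • φ (A.E i) := by
  conv_lhs => rw [A.E_span X]
  simp

theorem sum_liftMatrix_smul (φ : A.VM →ₛₗ[A.iota] A.V) (i : Fin A.dim) :
    ∑ j, A.liftMatrix i j • φ (A.E j) = A.s • φ (A.P (A.E i)) + A.q • φ (A.E i) := by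
  rw [A.map_eq_sum_frame φ (A.P (A.E i))]
  simp [liftMatrix, add_smul, Finset.sum_add_distrib, Finset.smul_sum, mul_smul, ite_smul]

theorem liftMatrix_mul_connQMatrix : A.liftMatrix * A.connQMatrix = 1 := by
  ext i k
  have hlift : A.lift (A.E i) = ∑ j, A.liftMatrix i j • A.tilde (A.E j) :=
    (A.lift_eq _).trans (A.sum_liftMatrix_smul A.tildeₛₗ i).symm
  have hconn := A.conn_lift_Q (A.E i)
  rw [hlift] at hconn
  change A.connLeft A.Q _ = _ at hconn
  have hk := congrArg (fun v => A.hBilin v (A.tilde (A.E k))) hconn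
  simp only [map_sum, map_smul, LinearMap.sum_apply, LinearMap.smul_apply, hBilin_apply,
    A.h_tilde, A.E_orth, smul_eq_mul] at hk
  rw [Matrix.mul_apply, Matrix.one_apply]
  refine Eq.trans hk ?_
  split_ifs <;> simp

/-- A semilinear map is recovered from its composition with `sP + q·Id`. -/
theorem frame_eq_sum_connQMatrix (φ : A.VM →ₛₗ[A.iota] A.V) (i : Fin A.dim) :
    φ (A.E i) = ∑ j, A.connQMatrix i j • (A.s • φ (A.P (A.E j)) + A.q • φ (A.E j)) := by
  have hinv : A.connQMatrix * A.liftMatrix = 1 :=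
    mul_eq_one_comm.mp A.liftMatrix_mul_connQMatrix
  simp_rw [← A.sum_liftMatrix_smul φ, Finset.smul_sum, smul_smul]
  rw [Finset.sum_comm]
  simp_rw [← Finset.sum_smul, ← Matrix.mul_apply, hinv, Matrix.one_apply]
  simp

theorem eq_zero_of_lift_eq_zero (φ : A.VM →ₛₗ[A.iota] A.V)
    (hφ : ∀ X, A.s • φ (A.P X) + A.q • φ X = 0) (X : A.VM) : φ X = 0 := by
  rw [A.map_eq_sum_frame φ]
  refine Finset.sum_eq_zero fun i _ => ?_
  rw [A.frame_eq_sum_connQMatrix φ]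
  simp [hφ]

theorem conn_S_tilde (X : A.VM) : A.conn A.S (A.tilde X) = 0 := by
  refine A.eq_zero_of_lift_eq_zero
    { toFun := fun X => A.conn A.S (A.tilde X)
      map_add' := fun X Y => by rw [A.tilde_add, A.conn_addr]
      map_smul' := fun f X => by
        rw [A.tilde_smul, A.conn_leib, A.app_S_iota, zero_smul, zero_add] } (fun X => ?_) X
  have hX := A.conn_S_lift X
  rw [A.lift_eq, A.conn_addr, A.conn_leib, A.conn_leib, A.app_S_s, A.app_S_q, one_smul,
    zero_smul, zero_add, add_assoc] at hX
  exact left_eq_add.mp hX.symm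

theorem conn_Q_tilde (X : A.VM) : A.conn A.Q (A.tilde X) = 0 := by
  refine A.eq_zero_of_lift_eq_zero
    { toFun := fun X => A.conn A.Q (A.tilde X)
      map_add' := fun X Y => by rw [A.tilde_add, A.conn_addr]
      map_smul' := fun f X => by
        rw [A.tilde_smul, A.conn_leib, A.app_Q_iota, zero_smul, zero_add] } (fun X => ?_) X
  have hX := A.conn_Q_lift X
  rw [A.lift_eq, A.conn_addr, A.conn_leib, A.conn_leib, A.app_Q_s, A.app_Q_q, one_smul,
    zero_smul, zero_add, add_left_comm] at hX
  exact left_eq_add.mp hX.symm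

theorem span_tilde_eq_top : Submodule.span A.F ({A.S, A.Q} ∪ Set.range A.tilde) = ⊤ := by
  refine eq_top_iff.mpr fun v _ => ?_
  obtain ⟨a, b, m, c, X, rfl⟩ := A.span v
  refine add_mem (add_mem (Submodule.smul_mem _ _ ?_) (Submodule.smul_mem _ _ ?_))
    (Submodule.sum_mem _ fun i _ => Submodule.smul_mem _ _ ?_) <;>
  exact Submodule.subset_span (by simp)

theorem span_lift_eq_top : Submodule.span A.F ({A.S, A.Q} ∪ Set.range A.lift) = ⊤ := by
  rw [eq_top_iff, ← A.span_tilde_eq_top, Submodule.span_le]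
  rintro _ (hv | ⟨X, rfl⟩)
  · exact Submodule.subset_span (Or.inl hv)
  · rw [SetLike.mem_coe, show A.tilde X = _ from A.map_eq_sum_frame A.tildeₛₗ X]
    refine Submodule.sum_mem _ fun i _ => Submodule.smul_mem _ _ ?_
    rw [A.frame_eq_sum_connQMatrix A.tildeₛₗ]
    refine Submodule.sum_mem _ fun j _ => Submodule.smul_mem _ _ ?_
    exact Submodule.subset_span (Or.inr ⟨A.E j, A.lift_eq _⟩)

/-- The covariant derivative `∇̃h` of the ambient metric. -/
def metricDefect (X Y Z : A.V) : A.F :=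
  A.app X (A.h Y Z) - A.h (A.conn X Y) Z - A.h Y (A.conn X Z)

theorem metricDefect_symm (X Y Z : A.V) : A.metricDefect X Y Z = A.metricDefect X Z Y := by
  simp only [metricDefect, A.h_symm Y, A.h_symm _ Z]
  ring

/-- `∇̃h` in its first slot, as a linear form. -/
def metricDefectDir (Y Z : A.V) : A.V →ₗ[A.F] A.F where
  toFun X := A.metricDefect X Y Z
  map_add' X X' := by
    simp only [metricDefect, A.app_addV, A.conn_addl, A.h_addl, A.h_addr]
    ring
  map_smul' f X := by
    simp only [metricDefect, A.app_smulV, A.conn_smull, A.h_smull, A.h_smulr, smul_eq_mul,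
      RingHom.id_apply]
    ring

/-- `∇̃h` in its second slot, as a linear form. -/
def metricDefectLeft (X Z : A.V) : A.V →ₗ[A.F] A.F where
  toFun Y := A.metricDefect X Y Z
  map_add' Y Y' := by
    simp only [metricDefect, A.app_add, A.conn_addr, A.h_addl]
    ring
  map_smul' f Y := by
    simp only [metricDefect, A.app_mul, A.conn_leib, A.h_addl, A.h_smull, smul_eq_mul,
      RingHom.id_apply]
    ring

theorem h_tilde_S (X : A.VM) : A.h (A.tilde X) A.S = 0 := by rw [A.h_symm, A.h_S_tilde]

theorem h_tilde_Q (X : A.VM) : A.h (A.tilde X) A.Q = 0 := by rw [A.h_symm, A.h_Q_tilde]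

theorem h_Q_S : A.h A.Q A.S = 1 := by rw [A.h_symm, A.h_S_Q]

theorem metricDefect_eq_zero_of_frame (X : A.V) (hSS : A.metricDefect X A.S A.S = 0)
    (hSQ : A.metricDefect X A.S A.Q = 0) (hQQ : A.metricDefect X A.Q A.Q = 0)
    (hST : ∀ Z, A.metricDefect X A.S (A.tilde Z) = 0)
    (hQT : ∀ Z, A.metricDefect X A.Q (A.tilde Z) = 0)
    (hTT : ∀ Y Z, A.metricDefect X (A.tilde Y) (A.tilde Z) = 0) (Y Z : A.V) :
    A.metricDefect X Y Z = 0 := by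
  have reduce (Z : A.V) (hS : A.metricDefect X A.S Z = 0) (hQ : A.metricDefect X A.Q Z = 0)
      (hT : ∀ Y, A.metricDefect X (A.tilde Y) Z = 0) (Y : A.V) : A.metricDefect X Y Z = 0 := by
    have hzero : A.metricDefectLeft X Z = 0 := by
      refine LinearMap.ext_on A.span_tilde_eq_top ?_
      rintro _ ((rfl | rfl) | ⟨W, rfl⟩)
      exacts [hS, hQ, hT W]
    exact LinearMap.congr_fun hzero Y
  refine reduce Z ?_ ?_ (fun W => ?_) Y <;> rw [A.metricDefect_symm]
  · exact reduce _ hSS (by rwa [A.metricDefect_symm])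
      (fun W => by rw [A.metricDefect_symm]; exact hST W) Z
  · exact reduce _ hSQ hQQ (fun W => by rw [A.metricDefect_symm]; exact hQT W) Z
  · exact reduce _ (hST W) (hQT W) (fun Y => hTT Y W) Z

theorem metricDefect_S (Y Z : A.V) : A.metricDefect A.S Y Z = 0 := by
  apply A.metricDefect_eq_zero_of_frame <;> intros <;>
  simp [metricDefect, h_S_S, h_S_Q, h_Q_Q, h_S_tilde, h_Q_tilde, h_tilde, app_zero, app_one,
    app_S_iota, conn_S_S, conn_S_Q, conn_S_tilde, h_zerol, h_zeror]

theorem metricDefect_Q (Y Z : A.V) : A.metricDefect A.Q Y Z = 0 := by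
  apply A.metricDefect_eq_zero_of_frame <;> intros <;>
  simp [metricDefect, h_S_S, h_S_Q, h_Q_Q, h_S_tilde, h_Q_tilde, h_tilde, app_zero, app_one,
    app_Q_iota, conn_Q_S, conn_Q_Q, conn_Q_tilde, h_zerol, h_zeror]

theorem metricDefect_lift (X : A.VM) (Y Z : A.V) : A.metricDefect (A.lift X) Y Z = 0 := by
  apply A.metricDefect_eq_zero_of_frame <;> intros <;>
  simp [metricDefect, h_S_S, h_S_Q, h_Q_Q, h_Q_S, h_S_tilde, h_Q_tilde, h_tilde, h_tilde_S,
    h_tilde_Q, app_zero, app_one, app_lift_iota, conn_lift_S, conn_lift_Q, conn_lift_tilde,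
    h_subl, h_subr, h_smull, h_smulr, P_dual, conn0_metric]

theorem metricDefect_eq_zero (X Y Z : A.V) : A.metricDefect X Y Z = 0 := by
  have hzero : A.metricDefectDir Y Z = 0 := by
    refine LinearMap.ext_on A.span_lift_eq_top ?_
    rintro _ ((rfl | rfl) | ⟨W, rfl⟩)
    exacts [A.metricDefect_S Y Z, A.metricDefect_Q Y Z, A.metricDefect_lift W Y Z]
  exact LinearMap.congr_fun hzero X

end ExplicitAmbient

/-!
STATEMENT 12.  For the explicit ambient manifold M̃ = ℝ × M × ℝ⁺ over a
pseudo-Riemannian manifold (M,g), with the metric h and the connection ∇̃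
defined using the Schouten tensor P and the bundle automorphism f, the
connection is metric: ∇̃h = 0.
-/
theorem stmt12 (A : ExplicitAmbient) :
    ∀ X Y Z : A.V, A.app X (A.h Y Z) = A.h (A.conn X Y) Z + A.h Y (A.conn X Z) := by
  intro X Y Z
  have hXYZ := A.metricDefect_eq_zero X Y Z
  rwa [ExplicitAmbient.metricDefect, sub_sub, sub_eq_zero] at hXYZ
end
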